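/- Let T₄ be the set of identities satisfied by every monoid with exactly four elements. Then the set of Birkhoff-closed sets of identities containing T₄ has cardinality 2^ℵ₀; that is, the monoid variety generated by all monoids of order four has continuum many subvarieties. -/

import Mathlib

/-- Words over the countably infinite alphabet `A = ℕ`: elements of the free monoid `A*`. -/
abbrev Word : Type := FreeMonoid ℕ

/-- A monoid `M` satisfies the identity `u ≈ v` if every monoid homomorphism
from the free monoid `A*` to `M` identifies `u` and `v`. -/
def Satisfies (M : Type*) [Monoid M] (u v : Word) : Prop :=
  ∀ f : Word →* M, f u = f v

/-- A word `w` is an isoterm for a monoid `M` if the only word `w'` with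
`M ⊨ w ≈ w'` is `w' = w`. -/
def Isoterm (M : Type*) [Monoid M] (w : Word) : Prop :=
  ∀ w' : Word, Satisfies M w w' → w' = w

/-- The set of identities satisfied by the monoid `M`. -/
def Th (M : Type*) [Monoid M] : Set (Word × Word) :=
  {p | Satisfies M p.1 p.2}

/-- A set `E` of identities is Birkhoff-closed if every identity satisfied by
every monoid satisfying all identities of `E` already belongs to `E`. -/
def BirkhoffClosed (E : Set (Word × Word)) : Prop :=
  ∀ u v : Word,
    (∀ (M : Type) [Monoid M], (∀ p ∈ E, Satisfies M p.1 p.2) → Satisfies M u v) →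
    (u, v) ∈ E

/-- The set of identities satisfied by every monoid with exactly four elements. -/
def T4 : Set (Word × Word) :=
  {p | ∀ (M : Type) [Monoid M], Nat.card M = 4 → Satisfies M p.1 p.2}

namespace FourElementMonoids

/-! ### Words in which every letter occurs at most twice are isoterms -/

/-- The cyclic monoid `{1, x, x², 0}` with `x³ = 0`, the exponents being stored in `Fin 4`. -/
@[ext] structure TruncatedPowers where
  exponent : Fin 4

namespace TruncatedPowers

instance : Monoid TruncatedPowers where
  mul a b := ⟨⟨min (a.exponent + b.exponent : ℕ) 3, by omega⟩⟩
  one := ⟨0⟩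
  mul_assoc a b c := by
    ext
    change min (min (a.exponent + b.exponent : ℕ) 3 + c.exponent : ℕ) 3 =
      min (a.exponent + min (b.exponent + c.exponent : ℕ) 3 : ℕ) 3
    omega
  one_mul a := by
    ext
    change min (0 + a.exponent : ℕ) 3 = a.exponent
    omega
  mul_one a := by
    ext
    change min (a.exponent + 0 : ℕ) 3 = a.exponent
    omega

theorem card_eq_four : Nat.card TruncatedPowers = 4 := by
  rw [Nat.card_congr (⟨exponent, mk, fun _ => rfl, fun _ => rfl⟩ : TruncatedPowers ≃ Fin 4)]
  simp

theorem exponent_mul (a b : TruncatedPowers) :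
    ((a * b).exponent : ℕ) = min (a.exponent + b.exponent : ℕ) 3 := rfl

theorem exponent_prod_indicator {α : Type*} [DecidableEq α] (a : α) (l : List α) :
    ((l.map fun c => (⟨if c = a then 1 else 0⟩ : TruncatedPowers)).prod.exponent : ℕ) =
      min (l.count a) 3 := by
  induction l with
  | nil => rfl
  | cons c l ih =>
    rw [List.map_cons, List.prod_cons, exponent_mul, ih, List.count_cons]
    by_cases h : c = a
    · simp [h]; omega
    · simp [h]

end TruncatedPowers

/-- Deletes all letters but `a` and `b`, and renames these to `true` and `false`. -/
def project (a b : ℕ) (l : List ℕ) : List Bool :=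
  l.filterMap fun c => if c = a then some true else if c = b then some false else none

theorem eq_of_project_eq (l l' : List ℕ)
    (h : ∀ a b, a ≠ b → project a b l = project a b l') : l = l' := by
  induction l generalizing l' with
  | nil =>
    cases l' with
    | nil => rfl
    | cons c l' => simpa [project] using h c (c + 1) (by omega)
  | cons c l ih =>
    cases l' with
    | nil => simpa [project] using h c (c + 1) (by omega)
    | cons d l' =>
      by_cases hcd : c = d
      · subst hcd
        rw [ih l']
        intro a b hab
        have := h a b hab
        by_cases hca : c = a
        · simpa [project, List.filterMap_cons, hca] using this
        · by_cases hcb : c = b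
          · subst hcb
            simpa [project, List.filterMap_cons, hca] using this
          · simpa [project, List.filterMap_cons, hca, hcb] using this
      · have := h c d hcd
        simp [project, Ne.symm hcd] at this

theorem prod_map_project {M : Type*} [Monoid M] (a b : ℕ) (m : Bool → M) (l : List ℕ) :
    ((project a b l).map m).prod =
      (l.map fun c => if c = a then m true else if c = b then m false else 1).prod := by
  induction l with
  | nil => rfl
  | cons c l ih =>
    rw [List.map_cons, List.prod_cons, ← ih]
    by_cases hca : c = a
    · simp [project, hca]
    · by_cases hcb : c = b
      · subst hcb
        simp [project, hca]
      · simp [project, hca, hcb]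

theorem count_project_le (a b : ℕ) (l : List ℕ) (h : ∀ c, l.count c ≤ 2) (t : Bool) :
    (project a b l).count t ≤ 2 := by
  have key : ∀ l : List ℕ, (project a b l).count true ≤ l.count a ∧
      (project a b l).count false ≤ l.count b := by
    intro l
    induction l with
    | nil => simp [project]
    | cons c l ih =>
      by_cases hca : c = a
      · subst hca
        simp only [project, List.filterMap_cons, List.count_cons] at ih ⊢
        simp
        omega
      · by_cases hcb : c = b
        · subst hcb
          simp only [project, List.filterMap_cons, List.count_cons] at ih ⊢
          simp [hca]
          omega
        · simpa [project, List.filterMap_cons, List.count_cons, hca, hcb] using ih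
  cases t
  · exact (key l).2.trans (h b)
  · exact (key l).1.trans (h a)

instance : DecidableEq (Function.End Bool) := inferInstanceAs (DecidableEq (Bool → Bool))

/-- The constant transformation of `Bool` with value `c`. -/
def const (c : Bool) : Function.End Bool := fun _ => c

/-- The letter `t` acts as a constant transformation, the other letter as the transposition. -/
def constOrNot (t s c : Bool) : Function.End Bool := if c = t then fun _ => s else Bool.not

set_option synthInstance.maxSize 1000 in
set_option synthInstance.maxHeartbeats 200000 in
/-- The transformation monoid of `Bool` and its dual separate short binary words in which
both letters occur at most twice. -/
theorem ofFn_eq_of_prod_eq : ∀ n : Fin 5, ∀ x y : Fin n → Bool,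
    (∀ t, (List.ofFn x).count t ≤ 2) → (∀ t, (List.ofFn x).count t = (List.ofFn y).count t) →
    (∀ t s, ((List.ofFn x).map (constOrNot t s)).prod =
      ((List.ofFn y).map (constOrNot t s)).prod) →
    ((List.ofFn x).map const).prod = ((List.ofFn y).map const).prod →
    ((List.ofFn x).reverse.map const).prod = ((List.ofFn y).reverse.map const).prod →
    x = y := by
  decide +kernel

theorem unop_prod_map_op {M α : Type*} [Monoid M] (m : α → M) (l : List α) :
    (l.map fun c => MulOpposite.op (m c)).prod.unop = (l.reverse.map m).prod := by
  induction l with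
  | nil => rfl
  | cons c l ih => simp [ih]

theorem binary_eq_of_prod_eq (x y : List Bool) (hx : ∀ t, x.count t ≤ 2)
    (h : ∀ (M : Type) [Monoid M], Nat.card M = 4 → ∀ m : Bool → M,
      (x.map m).prod = (y.map m).prod) : x = y := by
  have hcount : ∀ t, x.count t = y.count t := by
    intro t
    have := congrArg (fun z : TruncatedPowers => (z.exponent : ℕ))
      (h TruncatedPowers TruncatedPowers.card_eq_four fun c => ⟨if c = t then 1 else 0⟩)
    simp only [TruncatedPowers.exponent_prod_indicator] at this
    have := hx t
    omega
  have hlen : x.length = y.length := by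
    rw [← List.count_true_add_count_false (l := x), ← List.count_true_add_count_false (l := y),
      hcount, hcount]
  have hlen_lt : x.length < 5 := by
    rw [← List.count_true_add_count_false (l := x)]
    have := hx true
    have := hx false
    omega
  have hEnd : Nat.card (Function.End Bool) = 4 := by
    change Nat.card (Bool → Bool) = 4
    simp
  have hop : Nat.card (Function.End Bool)ᵐᵒᵖ = 4 := by
    rw [← Nat.card_congr MulOpposite.opEquiv, hEnd]
  have ex : List.ofFn x.get = x := List.ofFn_get x
  have ey : List.ofFn (fun i : Fin x.length => y.get (i.cast hlen)) = y := by
    apply List.ext_getElem <;> simp [hlen]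
  have key := ofFn_eq_of_prod_eq ⟨x.length, hlen_lt⟩ x.get (fun i => y.get (i.cast hlen))
  simp only [ex, ey] at key
  rw [← ex, key hx hcount (fun t s => h _ hEnd _) (h _ hEnd _) ?_, ey]
  have := congrArg MulOpposite.unop
    (h _ hop fun c => MulOpposite.op (const c))
  simpa only [unop_prod_map_op] using this

theorem eq_of_mem_T4 {u v : Word} (h : (u, v) ∈ T4) (hu : ∀ c, u.toList.count c ≤ 2) :
    u = v := by
  apply FreeMonoid.toList.injective
  apply eq_of_project_eq
  intro a b hab
  apply binary_eq_of_prod_eq _ _ (count_project_le a b _ hu)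
  intro M _ hM m
  rw [prod_map_project, prod_map_project, ← FreeMonoid.lift_apply, ← FreeMonoid.lift_apply]
  exact h M hM _

theorem map_mem_T4 {u v : Word} (h : (u, v) ∈ T4) (g : Word →* Word) : (g u, g v) ∈ T4 :=
  fun M _ hM f => h M hM (f.comp g)

theorem swap_mem_T4 {u v : Word} (h : (u, v) ∈ T4) : (v, u) ∈ T4 :=
  fun M _ hM f => (h M hM f).symm

/-! ### The Rees quotient of the free monoid by the non-factors of a word -/

theorem not_isInfix_append {l₁ l₂ w : List ℕ} (h : ¬ l₁ <:+: w ∨ ¬ l₂ <:+: w) :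
    ¬ l₁ ++ l₂ <:+: w := by
  intro hw
  rcases h with h | h
  · exact h ((List.prefix_append l₁ l₂).isInfix.trans hw)
  · exact h ((List.suffix_append l₁ l₂).isInfix.trans hw)

/-- The Rees congruence modulo the ideal of all words that are not factors of `w`. -/
def factorCon (w : List ℕ) : Con Word where
  r u v := u = v ∨ (¬ u.toList <:+: w ∧ ¬ v.toList <:+: w)
  iseqv :=
    { refl := fun _ => Or.inl rfl
      symm := by
        rintro u v (h | h)
        · exact Or.inl h.symm
        · exact Or.inr h.symm
      trans := by
        rintro u v x (rfl | h) (rfl | h')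
        · exact Or.inl rfl
        · exact Or.inr h'
        · exact Or.inr h
        · exact Or.inr ⟨h.1, h'.2⟩ }
  mul' := by
    rintro u v x y (rfl | h) (rfl | h')
    · exact Or.inl rfl
    · exact Or.inr ⟨not_isInfix_append (Or.inr h'.1), not_isInfix_append (Or.inr h'.2)⟩
    · exact Or.inr ⟨not_isInfix_append (Or.inl h.1), not_isInfix_append (Or.inl h.2)⟩
    · exact Or.inr ⟨not_isInfix_append (Or.inl h.1), not_isInfix_append (Or.inl h.2)⟩

theorem factorCon_iff {w : List ℕ} {u v : Word} :
    factorCon w u v ↔ u = v ∨ (¬ u.toList <:+: w ∧ ¬ v.toList <:+: w) := Iff.rfl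

theorem satisfies_quotient_iff (c : Con Word) (u v : Word) :
    Satisfies c.Quotient u v ↔ ∀ g : Word →* Word, c (g u) (g v) := by
  constructor
  · intro h g
    exact c.eq.1 (h (c.mk'.comp g))
  · intro h f
    have hf : c.mk'.comp (FreeMonoid.lift fun a => (f (FreeMonoid.of a)).out) = f := by
      apply FreeMonoid.hom_eq
      intro a
      simp only [MonoidHom.comp_apply, FreeMonoid.lift_eval_of]
      exact Quotient.out_eq _
    rw [← hf]
    exact c.eq.2 (h _)

theorem satisfies_of_mem_T4 {w : List ℕ} (hw : ∀ c, w.count c ≤ 2) {u v : Word}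
    (h : (u, v) ∈ T4) : Satisfies (factorCon w).Quotient u v := by
  rw [satisfies_quotient_iff]
  intro g
  rw [factorCon_iff]
  by_cases hu : (g u).toList <:+: w
  · exact Or.inl (eq_of_mem_T4 (map_mem_T4 h g) fun c => (hu.sublist.count_le c).trans (hw c))
  by_cases hv : (g v).toList <:+: w
  · exact Or.inl (eq_of_mem_T4 (swap_mem_T4 (map_mem_T4 h g))
      fun c => (hv.sublist.count_le c).trans (hw c)).symm
  exact Or.inr ⟨hu, hv⟩

/-! ### An infinite antichain of words -/

/-- The letter at position `p` of `cycleWord n`. -/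
def cycleLetter (n p : ℕ) : ℕ := if p % 2 = 0 then (p / 2 + 1) % n else p / 2

/-- The word `1 0 2 1 3 2 ⋯ (n-1) (n-2) 0 (n-1)`, in which every letter occurs twice and
occurrences of two letters interlace precisely when they are neighbours modulo `n`. -/
def cycleWord (n : ℕ) : List ℕ := (List.range (2 * n)).map (cycleLetter n)

theorem length_cycleWord (n : ℕ) : (cycleWord n).length = 2 * n := by simp [cycleWord]

theorem getElem_cycleWord (n p : ℕ) (h : p < (cycleWord n).length) :
    (cycleWord n)[p] = cycleLetter n p := by simp [cycleWord]

theorem cycleLetter_eq {n p : ℕ} (h : p < 2 * n) :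
    cycleLetter n p = if p % 2 = 1 then p / 2 else if p = 2 * n - 2 then 0 else p / 2 + 1 := by
  unfold cycleLetter
  rcases Nat.mod_two_eq_zero_or_one p with hp | hp
  · by_cases hn : p = 2 * n - 2
    · have : p / 2 + 1 = n := by omega
      rw [this]
      simp [← hn, hp]
    · have : p / 2 + 1 < n := by omega
      simp [hp, hn, Nat.mod_eq_of_lt this]
  · simp [hp]

theorem cycleLetter_lt {n p : ℕ} (h : p < 2 * n) : cycleLetter n p < n := by
  rw [cycleLetter_eq h]
  split_ifs <;> omega

theorem gap_of_cycleLetter_eq {n p q : ℕ} (hn : 2 ≤ n) (hpq : p < q) (hq : q < 2 * n)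
    (h : cycleLetter n p = cycleLetter n q) :
    (p % 2 = 0 ∧ q = p + 3) ∨ (p = 1 ∧ q = 2 * n - 2) := by
  rw [cycleLetter_eq (hpq.trans hq), cycleLetter_eq hq] at h
  split_ifs at h <;> omega

theorem count_cycleWord_le (n c : ℕ) : (cycleWord n).count c ≤ 2 := by
  have h : (cycleWord n).count c =
      ((Finset.range (2 * n)).filter fun p => cycleLetter n p = c).card := by
    rw [cycleWord, List.count, List.countP_map, List.countP_eq_length_filter]
    simp [Finset.card, Finset.filter, Finset.range, Multiset.range, Function.comp_def,
      beq_eq_decide]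
  rw [h]
  by_contra! hcard
  obtain ⟨p, hp, q, hq, r, hr, hpq, hpr, hqr⟩ := Finset.two_lt_card.1 hcard
  simp only [Finset.mem_filter, Finset.mem_range] at hp hq hr
  rw [cycleLetter_eq hp.1] at hp
  rw [cycleLetter_eq hq.1] at hq
  rw [cycleLetter_eq hr.1] at hr
  split_ifs at hp hq hr <;> omega

/-- If the image of the word `u` under a substitution `φ` is a factor of `w`, then the images of
the letters of `u` occupy consecutive blocks of positions in `w`. -/
theorem exists_block_positions {u w : List ℕ} {φ : ℕ → List ℕ} (h : u.flatMap φ <:+: w) :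
    ∃ F : ℕ → ℕ, ∀ p (hp : p < u.length), F (p + 1) = F p + (φ u[p]).length ∧
      F (p + 1) ≤ w.length ∧
      ∀ t (ht : t < (φ u[p]).length), w[F p + t]? = some (φ u[p])[t] := by
  obtain ⟨P, R, rfl⟩ := h
  refine ⟨fun p => P.length + ((u.take p).flatMap φ).length, fun p hp => ?_⟩
  have hsplit : u.flatMap φ = (u.take p).flatMap φ ++ (φ u[p] ++ (u.drop (p + 1)).flatMap φ) := by
    rw [← List.flatMap_cons, ← List.flatMap_append, List.getElem_cons_drop,
      List.take_append_drop]
  have hstep : ((u.take (p + 1)).flatMap φ).length =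
      ((u.take p).flatMap φ).length + (φ u[p]).length := by
    rw [List.take_add_one, List.flatMap_append]
    simp [hp]
  refine ⟨by simp only [hstep]; omega, ?_, fun t ht => ?_⟩
  · simp only [hstep, hsplit, List.length_append]
    omega
  · rw [hsplit]
    simp only [List.append_assoc]
    rw [List.getElem?_append_right (by omega), List.getElem?_append_right (by omega),
      List.getElem?_append_left (by omega), List.getElem?_eq_getElem (by omega)]
    congr 2
    omega

theorem eq_of_flatMap_cycleWord_isInfix {n k : ℕ} (hn : 4 ≤ n) (hk : 4 ≤ k) {φ : ℕ → List ℕ}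
    (hφ : (cycleWord n).flatMap φ <:+: cycleWord k) (hne : (cycleWord n).flatMap φ ≠ []) :
    n = k := by
  obtain ⟨F, hF⟩ := exists_block_positions hφ
  simp only [length_cycleWord, getElem_cycleWord] at hF
  have step : ∀ p, p < 2 * n → F (p + 1) = F p + (φ (cycleLetter n p)).length :=
    fun p hp => (hF p hp).1
  have bound : ∀ p, p < 2 * n → F (p + 1) ≤ 2 * k := fun p hp => (hF p hp).2.1
  have mono : ∀ p q, p ≤ q → q ≤ 2 * n → F p ≤ F q := by
    intro p q hpq
    induction q, hpq using Nat.le_induction with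
    | base => exact fun _ => le_rfl
    | succ q _ ih =>
      intro hq
      have := step q (by omega)
      have := ih (by omega)
      omega
  have letters : ∀ p q, p < q → q < 2 * n → cycleLetter n p = cycleLetter n q →
      ∀ t < (φ (cycleLetter n p)).length,
        ((F p + t) % 2 = 0 ∧ F q + t = F p + t + 3) ∨
          (F p + t = 1 ∧ F q + t = 2 * k - 2) := by
    intro p q hpq hq he t ht
    have h₁ := (hF p (by omega)).2.2 t ht
    have h₂ := (hF q hq).2.2 t (he ▸ ht)
    have := step p (by omega)
    have := step q hq
    have := bound q hq
    have := mono (p + 1) q (by omega) (by omega)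
    have ht' : t < (φ (cycleLetter n q)).length := he ▸ ht
    apply gap_of_cycleLetter_eq (by omega) (by omega) (by omega)
    rw [List.getElem?_eq_getElem (by rw [length_cycleWord]; omega), getElem_cycleWord] at h₁ h₂
    rw [Option.some_inj] at h₁ h₂
    rw [h₁, h₂]
    simp only [he]
  have even_letter : ∀ i, 1 ≤ i → i < n → cycleLetter n (2 * i - 2) = i := by
    intro i hi hin
    rw [cycleLetter_eq (by omega), if_neg (by omega), if_neg (by omega)]
    omega
  have odd_letter : ∀ i, i < n → cycleLetter n (2 * i + 1) = i := by
    intro i hin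
    rw [cycleLetter_eq (by omega), if_pos (by omega)]
    omega
  have last_letter : cycleLetter n (2 * n - 2) = 0 := by
    rw [cycleLetter_eq (by omega), if_neg (by omega), if_pos rfl]
  have first_letter : cycleLetter n 1 = 0 := odd_letter 0 (by omega)
  have outer := letters 1 (2 * n - 2) (by omega) (by omega) (by rw [first_letter, last_letter])
  rw [first_letter] at outer
  have step_one : F 2 = F 1 + (φ 0).length := by
    rw [step 1 (by omega), first_letter]
  have length_le : ∀ i < n, (φ i).length ≤ 1 := by
    intro i hi
    by_contra! hlen
    rcases Nat.eq_zero_or_pos i with rfl | hpos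
    · have := outer 0 (by omega)
      have := outer 1 (by omega)
      have := mono 2 (2 * n - 2) (by omega) (by omega)
      omega
    · have hl := letters (2 * i - 2) (2 * i + 1) (by omega) (by omega)
        (by rw [even_letter i hpos hi, odd_letter i hi])
      have hs := step (2 * i - 2) (by omega)
      rw [even_letter i hpos hi] at hl hs
      have := hl 0 (by omega)
      have := hl 1 (by omega)
      have := mono (2 * i - 2 + 1) (2 * i + 1) (by omega) (by omega)
      omega
  have neighbours : ∀ i, 1 ≤ i → i < n → φ i ≠ [] →
      (φ (i - 1)).length = 1 ∧ (i + 1 < n → (φ (i + 1)).length = 1) := by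
    intro i hpos hi hne
    have := List.length_pos_iff.2 hne
    have := length_le i hi
    have hl := letters (2 * i - 2) (2 * i + 1) (by omega) (by omega)
      (by rw [even_letter i hpos hi, odd_letter i hi])
    have h₀ := step (2 * i - 2) (by omega)
    rw [even_letter i hpos hi] at hl h₀
    have hl := hl 0 (by omega)
    have h₁ := step (2 * (i - 1) + 1) (by omega)
    rw [odd_letter (i - 1) (by omega)] at h₁
    have h₂ := step (2 * i) (by omega)
    have := length_le (i - 1) (by omega)
    have := length_le _ (cycleLetter_lt (n := n) (p := 2 * i) (by omega))
    rw [show 2 * i - 2 + 1 = 2 * (i - 1) + 1 by omega] at h₀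
    rw [show 2 * (i - 1) + 1 + 1 = 2 * i by omega] at h₁
    refine ⟨by omega, fun hi' => ?_⟩
    have h₃ := even_letter (i + 1) (by omega) hi'
    rw [show 2 * (i + 1) - 2 = 2 * i by omega] at h₃
    rw [h₃] at h₂ this
    omega
  have exists_pos : ∃ i, 1 ≤ i ∧ i < n ∧ φ i ≠ [] := by
    by_contra! hall
    have h₀ : φ 0 ≠ [] := by
      intro h₀
      apply hne
      rw [List.flatMap_eq_nil_iff]
      intro i hi
      obtain ⟨p, hp, rfl⟩ := List.mem_map.1 hi
      rcases Nat.eq_zero_or_pos (cycleLetter n p) with h | h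
      · rw [h, h₀]
      · exact hall _ h (cycleLetter_lt (List.mem_range.1 hp))
    have hpos := List.length_pos_iff.2 h₀
    have := length_le 0 (by omega)
    have const : ∀ q, 2 ≤ q → q ≤ 2 * n - 2 → F q = F 2 := by
      intro q hq
      induction q, hq using Nat.le_induction with
      | base => exact fun _ => rfl
      | succ q hq ih =>
        intro hq'
        rw [step q (by omega), hall (cycleLetter n q) ?_ (cycleLetter_lt (by omega)),
          ih (by omega)]
        · rfl
        · rw [cycleLetter_eq (by omega)]
          split_ifs <;> omega
    have := const (2 * n - 2) (by omega) le_rfl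
    have := outer 0 hpos
    omega
  obtain ⟨i, hpos, hi, hne_i⟩ := exists_pos
  have ne_one : φ 1 ≠ [] := by
    induction i, hpos using Nat.le_induction with
    | base => exact hne_i
    | succ i hpos ih =>
      have := (neighbours (i + 1) (by omega) hi hne_i).1
      exact ih (by omega) (List.length_pos_iff.1 (by simp only [Nat.add_sub_cancel] at this; omega))
  have length_eq_of_pos : ∀ j, 1 ≤ j → j < n → (φ j).length = 1 := by
    intro j hj
    induction j, hj using Nat.le_induction with
    | base =>
      have := List.length_pos_iff.2 ne_one
      have := length_le 1 (by omega)
      omega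
    | succ j hj ih =>
      intro hjn
      have := ih (by omega)
      exact (neighbours j hj (by omega) (List.length_pos_iff.1 (by omega))).2 hjn
  have length_eq : ∀ j < n, (φ j).length = 1 := by
    intro j hj
    rcases Nat.eq_zero_or_pos j with rfl | h
    · exact (neighbours 1 le_rfl (by omega) ne_one).1
    · exact length_eq_of_pos j h hj
  have shift : ∀ p, p ≤ 2 * n → F p = F 0 + p := by
    intro p
    induction p with
    | zero => simp
    | succ p ih =>
      intro hp
      rw [step p (by omega), length_eq _ (cycleLetter_lt (by omega)), ih (by omega), add_assoc]
  have := outer 0 (by rw [length_eq 0 (by omega)]; omega)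
  have := shift 1 (by omega)
  have := shift (2 * n - 2) (by omega)
  omega

/-! ### Continuum many closed sets of identities -/

/-- The identities satisfied by all the Rees quotients belonging to the words
`cycleWord (n + 4)` with `n ∈ S`. -/
def cycleTheory (S : Set ℕ) : Set (Word × Word) :=
  {p | ∀ n ∈ S, Satisfies (factorCon (cycleWord (n + 4))).Quotient p.1 p.2}

theorem birkhoffClosed_cycleTheory (S : Set ℕ) : BirkhoffClosed (cycleTheory S) :=
  fun _ _ h n hn => h _ fun _ hp => hp n hn

theorem T4_subset_cycleTheory (S : Set ℕ) : T4 ⊆ cycleTheory S :=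
  fun _ hp _ _ => satisfies_of_mem_T4 (count_cycleWord_le _) hp

theorem toList_map_eq_flatMap (g : Word →* Word) (l : List ℕ) :
    (g (FreeMonoid.ofList l)).toList = l.flatMap fun a => (g (FreeMonoid.of a)).toList := by
  induction l with
  | nil => simp
  | cons a l ih => simp [FreeMonoid.ofList_cons, ih]

theorem cycleWord_sq_mem_cycleTheory_iff (S : Set ℕ) (n : ℕ) :
    (FreeMonoid.ofList (cycleWord (n + 4)),
      FreeMonoid.ofList (cycleWord (n + 4)) * FreeMonoid.ofList (cycleWord (n + 4))) ∈
        cycleTheory S ↔ n ∉ S := by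
  constructor
  · intro h hn
    have := (satisfies_quotient_iff _ _ _).1 (h n hn) (MonoidHom.id Word)
    rcases factorCon_iff.1 this with h | h
    · have := congrArg (fun u : Word => u.toList.length) h
      simp [length_cycleWord] at this
    · exact h.1 List.infix_rfl
  · intro hn k hk
    rw [satisfies_quotient_iff]
    intro g
    rw [factorCon_iff, map_mul]
    by_cases h : (g (FreeMonoid.ofList (cycleWord (n + 4)))).toList = []
    · left
      rw [FreeMonoid.toList.injective (h.trans FreeMonoid.toList_one.symm), one_mul]
    · have hnot : ¬ (g (FreeMonoid.ofList (cycleWord (n + 4)))).toList <:+: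
          cycleWord (k + 4) := by
        intro hfactor
        rw [toList_map_eq_flatMap] at h hfactor
        have := eq_of_flatMap_cycleWord_isInfix (by omega) (by omega) hfactor h
        obtain rfl : n = k := by omega
        exact hn hk
      exact Or.inr ⟨hnot, not_isInfix_append (Or.inl hnot)⟩

theorem cycleTheory_injective : Function.Injective cycleTheory := by
  intro S S' h
  ext n
  rw [← not_iff_not, ← cycleWord_sq_mem_cycleTheory_iff, h, cycleWord_sq_mem_cycleTheory_iff]

end FourElementMonoids

open FourElementMonoids in
/-- The monoid variety generated by all monoids of order four has continuum
many subvarieties. -/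
theorem statement4 :
    Cardinal.mk {E : Set (Word × Word) // BirkhoffClosed E ∧ T4 ⊆ E} =
      Cardinal.continuum := by
  apply le_antisymm
  · refine (Cardinal.mk_subtype_le _).trans ?_
    have : Countable Word := inferInstanceAs (Countable (List ℕ))
    rw [Cardinal.mk_set, ← Cardinal.two_power_aleph0]
    exact Cardinal.power_le_power_left two_ne_zero Cardinal.mk_le_aleph0
  · rw [← Cardinal.two_power_aleph0, ← Cardinal.mk_nat, ← Cardinal.mk_set]
    exact Cardinal.mk_le_of_injective
      (f := fun S => ⟨cycleTheory S, birkhoffClosed_cycleTheory S, T4_subset_cycleTheory S⟩)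
      fun S S' h => cycleTheory_injective (Subtype.ext_iff.1 h)
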